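/- arXiv:1505.04202 — 2 statements merged into one kernel-verified Lean document; each statement's English description precedes it below -/
import Mathlib

section
/- Let L ≥ 1 and K ≥ 1 be integers with K ≤ L, and let n_1, …, n_K be positive integers with n_1 + ⋯ + n_K = L. Then the Shannon entropy of the probability vector (n_1/L, …, n_K/L) is at least the Shannon entropy of the probability vector ((L − K + 1)/L, 1/L, …, 1/L) (with K − 1 entries equal to 1/L); that is, −Σ_{k=1}^{K} (n_k/L)·log₂(n_k/L) ≥ −((L−K+1)/L)·log₂((L−K+1)/L) + ((K−1)/L)·log₂ L. -/
open Finset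

/-- The chord bound for the convex function `x ↦ x * log x` on `[1, M]`. -/
theorem sub_one_mul_mul_log_le {a M : ℝ} (ha : 1 ≤ a) (haM : a ≤ M) :
    (M - 1) * (a * Real.log a) ≤ (a - 1) * (M * Real.log M) := by
  rcases (ha.trans haM).eq_or_lt with hM | hM
  · obtain rfl : a = 1 := le_antisymm (hM ▸ haM) ha
    simp
  have hM' : 0 < M - 1 := by linarith
  have h := Real.convexOn_mul_log.2 (Set.mem_Ici.2 zero_le_one)
    (Set.mem_Ici.2 (by linarith : 0 ≤ M))
    (div_nonneg (by linarith) hM'.le : 0 ≤ (M - a) / (M - 1))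
    (div_nonneg (by linarith) hM'.le : 0 ≤ (a - 1) / (M - 1))
    (by field_simp; ring)
  have hcomb : (M - a) / (M - 1) * 1 + (a - 1) / (M - 1) * M = a := by
    field_simp; ring
  simp only [smul_eq_mul, hcomb, Real.log_one, mul_zero, zero_add] at h
  rwa [div_mul_eq_mul_div, le_div_iff₀ hM', mul_comm] at h

theorem sum_mul_log_le {ι : Type*} (s : Finset ι) {a : ι → ℝ} (ha : ∀ i ∈ s, 1 ≤ a i) :
    ∑ i ∈ s, a i * Real.log (a i)
      ≤ (∑ i ∈ s, (a i - 1) + 1) * Real.log (∑ i ∈ s, (a i - 1) + 1) := by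
  set M := ∑ i ∈ s, (a i - 1) + 1 with hM
  have hnonneg : ∀ i ∈ s, 0 ≤ a i - 1 := fun i hi => sub_nonneg.2 (ha i hi)
  have hle : ∀ i ∈ s, a i ≤ M := fun i hi => by
    linarith [single_le_sum hnonneg hi]
  have hM1 : 1 ≤ M := by linarith [sum_nonneg hnonneg]
  rcases hM1.eq_or_lt with h1 | h1
  · rw [← h1, Real.log_one, mul_zero]
    refine (sum_eq_zero fun i hi => ?_).le
    rw [le_antisymm (h1 ▸ hle i hi) (ha i hi), Real.log_one, mul_zero]
  · refine le_of_mul_le_mul_left ?_ (sub_pos.2 h1)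
    calc (M - 1) * ∑ i ∈ s, a i * Real.log (a i)
        = ∑ i ∈ s, (M - 1) * (a i * Real.log (a i)) := mul_sum ..
      _ ≤ ∑ i ∈ s, (a i - 1) * (M * Real.log M) :=
          sum_le_sum fun i hi => sub_one_mul_mul_log_le (ha i hi) (hle i hi)
      _ = (M - 1) * (M * Real.log M) := by rw [← sum_mul, hM, add_sub_cancel_right]

/-- Among all `K`-level quantizers of a uniform source on an alphabet of size `L`
(with positive bin sizes `n 1, …, n K` summing to `L`), the extended max-search quantizer
`(L - K + 1, 1, …, 1)` has the smallest induced Shannon entropy: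
`-Σ_k (n_k/L) log₂ (n_k/L) ≥ -((L-K+1)/L) log₂ ((L-K+1)/L) + ((K-1)/L) log₂ L`. -/
theorem entropy_ge_extended_max_search
    (L K : ℕ) (hK : 1 ≤ K) (hKL : K ≤ L)
    (n : Fin K → ℕ) (hn : ∀ k, 1 ≤ n k) (hsum : ∑ k, n k = L) :
    (-∑ k, ((n k : ℝ) / L) * Real.logb 2 ((n k : ℝ) / L))
      ≥ -(((L : ℝ) - K + 1) / L) * Real.logb 2 (((L : ℝ) - K + 1) / L)
        + (((K : ℝ) - 1) / L) * Real.logb 2 (L : ℝ) := by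
  have hL : (0 : ℝ) < L := by exact_mod_cast hK.trans hKL
  have hKL' : (K : ℝ) ≤ L := by exact_mod_cast hKL
  have hsum' : ∑ k, (n k : ℝ) = L := by exact_mod_cast hsum
  have hM : ∑ k, ((n k : ℝ) - 1) + 1 = (L : ℝ) - K + 1 := by
    simp [sum_sub_distrib, hsum']
  have key := sum_mul_log_le univ (a := fun k => (n k : ℝ))
    fun k _ => by exact_mod_cast hn k
  rw [hM] at key
  have hlhs : ∑ k, ((n k : ℝ) / L) * Real.logb 2 ((n k : ℝ) / L)
      = (∑ k, (n k : ℝ) * Real.log (n k)) / (L * Real.log 2) - Real.log L / Real.log 2 := by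
    have hterm : ∀ k, ((n k : ℝ) / L) * Real.logb 2 ((n k : ℝ) / L)
        = (n k : ℝ) * Real.log (n k) / (L * Real.log 2)
          - n k * (Real.log L / (L * Real.log 2)) := fun k => by
      have hk : (n k : ℝ) ≠ 0 := by exact_mod_cast Nat.one_le_iff_ne_zero.1 (hn k)
      rw [Real.logb, Real.log_div hk hL.ne']
      field_simp
    rw [sum_congr rfl fun k _ => hterm k, sum_sub_distrib, ← sum_div, ← sum_mul, hsum']
    field_simp
  have hrhs : -(((L : ℝ) - K + 1) / L) * Real.logb 2 (((L : ℝ) - K + 1) / L)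
        + (((K : ℝ) - 1) / L) * Real.logb 2 (L : ℝ)
      = -((((L : ℝ) - K + 1) * Real.log ((L : ℝ) - K + 1)) / (L * Real.log 2)
        - Real.log L / Real.log 2) := by
    rw [Real.logb, Real.logb, Real.log_div (by linarith) hL.ne']
    field_simp
    ring
  rw [hlhs, hrhs, ge_iff_le, neg_le_neg_iff]
  gcongr
end

section
/- For every integer N ≥ 2, writing a = N·2^{−N}, the inequality (1 − a) · log₂( N / (1 − a) ) ≤ log₂ N holds. -/
/-- The elementary bound `-x log x ≤ 1 - x`, for `x > 0`. -/
lemma Real.neg_mul_log_le_one_sub {x : ℝ} (hx : 0 < x) : -(x * Real.log x) ≤ 1 - x := by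
  have h := mul_le_mul_of_nonneg_left (Real.one_sub_inv_le_log_of_pos hx) hx.le
  rw [mul_sub, mul_inv_cancel₀ hx.ne'] at h
  linarith

/-- The key inequality in the inductive delay bound for binary search: for every `N ≥ 2`,
writing `a = N·2^{-N}`, we have `(1 - a) log₂ (N / (1 - a)) ≤ log₂ N`. -/
theorem binary_search_delay_key_inequality (N : ℕ) (hN : 2 ≤ N) :
    (1 - (N : ℝ) * (2 : ℝ) ^ (-(N : ℤ))) *
        Real.logb 2 ((N : ℝ) / (1 - (N : ℝ) * (2 : ℝ) ^ (-(N : ℤ))))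
      ≤ Real.logb 2 (N : ℝ) := by
  have hN0 : (0 : ℝ) < N := by positivity
  have ha0 : 0 < (N : ℝ) * (2 : ℝ) ^ (-(N : ℤ)) := by positivity
  have ha1 : (N : ℝ) * (2 : ℝ) ^ (-(N : ℤ)) < 1 := by
    rw [zpow_neg, zpow_natCast, ← div_eq_mul_inv, div_lt_one (by positivity)]
    exact_mod_cast N.lt_two_pow_self
  rcases hN.eq_or_lt with rfl | h3
  · have h : (1 - ((2 : ℕ) : ℝ) * (2 : ℝ) ^ (-((2 : ℕ) : ℤ))) = 1 / 2 := by norm_num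
    have h4 : Real.logb 2 (4 : ℝ) = 2 := by
      rw [show (4 : ℝ) = 2 ^ (2 : ℕ) by norm_num, Real.logb_pow]
      norm_num
    rw [h]
    norm_num [h4]
  · generalize (N : ℝ) * (2 : ℝ) ^ (-(N : ℤ)) = a at ha0 ha1
    have hx : 0 < 1 - a := sub_pos.2 ha1
    have hlog : 1 ≤ Real.log N := by
      rw [Real.le_log_iff_exp_le hN0]
      have : (3 : ℝ) ≤ N := by exact_mod_cast h3
      linarith [Real.exp_one_lt_d9]
    rw [Real.logb, Real.logb, Real.log_div hN0.ne' hx.ne', ← mul_div_assoc]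
    gcongr
    nlinarith [Real.neg_mul_log_le_one_sub hx]
end
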